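/- Let κ : (0,∞) → ℝ be a locally integrable completely monotone (LICM) function that is not identically zero. Then the equation (κ∗λ)(t) = t for all t > 0 has a unique locally integrable solution λ, and this solution is a Bernstein function. -/

import Mathlib

open MeasureTheory Set Filter Topology

noncomputable section

/-- A real-valued function on `(0,∞)` is completely monotone (CM): infinitely
differentiable on `(0,∞)` with `(-1)^n f⁽ⁿ⁾(t) ≥ 0` for all `t > 0` and `n ∈ ℕ`. -/
def ScalarCM (f : ℝ → ℝ) : Prop :=
  ContDiffOn ℝ (⊤ : ℕ∞) f (Set.Ioi 0) ∧
  ∀ n : ℕ, ∀ t ∈ Set.Ioi (0:ℝ), 0 ≤ (-1 : ℝ) ^ n * iteratedDeriv n f t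

/-- Locally integrable completely monotone (LICM): CM and integrable over `(0,1]`. -/
def ScalarLICM (f : ℝ → ℝ) : Prop :=
  ScalarCM f ∧ MeasureTheory.IntegrableOn f (Set.Ioc 0 1)

/-- A Bernstein function: nonnegative, differentiable on `(0,∞)`, with CM derivative. -/
def ScalarBernstein (f : ℝ → ℝ) : Prop :=
  (∀ t ∈ Set.Ioi (0:ℝ), 0 ≤ f t) ∧ DifferentiableOn ℝ f (Set.Ioi 0) ∧ ScalarCM (deriv f)

theorem abs_taylor_remainder_le {f f1 f2 : ℝ → ℝ} {a b C : ℝ}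
    (h0 : ∀ t ∈ Icc a b, HasDerivAt f (f1 t) t) (h1 : ∀ t ∈ Icc a b, HasDerivAt f1 (f2 t) t)
    (hC : ∀ t ∈ Icc a b, |f2 t| ≤ C) {s t : ℝ} (hs : s ∈ Icc a b) (ht : t ∈ Icc a b) :
    |f s - f t - (s - t) * f1 t| ≤ C * |s - t| * |s - t| := by
  have hsub : uIcc t s ⊆ Icc a b := ordConnected_Icc.uIcc_subset ht hs
  have key : ∀ u ∈ uIcc t s, ‖f1 u - f1 t‖ ≤ C * |s - t| := by
    intro u hu
    have := (convex_Icc a b).norm_image_sub_le_of_norm_hasDerivWithin_le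
      (fun x hx => (h1 x hx).hasDerivWithinAt) (fun x hx => hC x hx) ht (hsub hu)
    refine this.trans ?_
    have hC0 : 0 ≤ C := (abs_nonneg _).trans (hC t ht)
    refine mul_le_mul_of_nonneg_left ?_ hC0
    rw [Real.norm_eq_abs]
    exact abs_sub_left_of_mem_uIcc hu
  have := (convex_uIcc t s).norm_image_sub_le_of_norm_hasDerivWithin_le
      (f := fun u => f u - (u - t) * f1 t) (f' := fun u => f1 u - f1 t)
      (fun x hx => by
        have := (h0 x (hsub hx)).sub (((hasDerivAt_id x).sub_const t).mul_const (f1 t))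
        simp only [one_mul, id] at this
        exact this.hasDerivWithinAt) key left_mem_uIcc right_mem_uIcc
  simp only [sub_self, zero_mul, sub_zero, Real.norm_eq_abs] at this
  rwa [show f s - f t - (s - t) * f1 t = f s - (s - t) * f1 t - f t by ring]

theorem hasDerivAt_of_tendsto_of_deriv_bounded {f f1 f2 : ℕ → ℝ → ℝ} {F : ℝ → ℝ}
    (h0 : ∀ n, ∀ t > 0, HasDerivAt (f n) (f1 n t) t)
    (h1 : ∀ n, ∀ t > 0, HasDerivAt (f1 n) (f2 n t) t)
    (hb : ∀ a b, 0 < a → ∃ C, ∀ᶠ n in atTop, ∀ t ∈ Icc a b, |f2 n t| ≤ C)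
    (hF : ∀ t > 0, Tendsto (fun n => f n t) atTop (𝓝 (F t))) :
    ∃ F1 : ℝ → ℝ, ∀ t > 0, Tendsto (fun n => f1 n t) atTop (𝓝 (F1 t)) ∧
      HasDerivAt F (F1 t) t := by
  suffices h : ∀ t > 0, ∃ l, Tendsto (fun n => f1 n t) atTop (𝓝 l) ∧ HasDerivAt F l t by
    choose! F1 hF1 using h
    exact ⟨F1, hF1⟩
  intro t ht
  obtain ⟨C, hC⟩ := hb (t / 2) (2 * t) (by positivity)
  have htI : t ∈ Icc (t / 2) (2 * t) := ⟨by linarith, by linarith⟩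
  have hT : ∀ᶠ n in atTop, ∀ s ∈ Icc (t / 2) (2 * t),
      |f n s - f n t - (s - t) * f1 n t| ≤ C * |s - t| * |s - t| := by
    filter_upwards [hC] with n hn s hs
    exact abs_taylor_remainder_le (fun u hu => h0 n u (by linarith [hu.1]))
      (fun u hu => h1 n u (by linarith [hu.1])) hn hs htI
  have hcau : CauchySeq fun n => f1 n t := by
    rw [Metric.cauchySeq_iff']
    intro ε hε
    obtain ⟨h, hh0, hht, hhε⟩ : ∃ h : ℝ, 0 < h ∧ h ≤ t ∧ C * h < ε / 4 := by
      refine ⟨min t (ε / (8 * (|C| + 1))), by positivity, min_le_left _ _, ?_⟩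
      have h1 : min t (ε / (8 * (|C| + 1))) ≤ ε / (8 * (|C| + 1)) := min_le_right _ _
      have h2 : 0 ≤ min t (ε / (8 * (|C| + 1))) := by positivity
      calc C * min t (ε / (8 * (|C| + 1))) ≤ (|C| + 1) * (ε / (8 * (|C| + 1))) := by
            refine mul_le_mul ?_ h1 h2 (by positivity)
            linarith [le_abs_self C]
        _ = ε / 8 := by field_simp
        _ < ε / 4 := by linarith
    have hq : CauchySeq fun n => (f n (t + h) - f n t) / h :=
      (((hF (t + h) (by linarith)).sub (hF t ht)).div_const h).cauchySeq
    obtain ⟨N1, hN1⟩ := Metric.cauchySeq_iff.1 hq (ε / 4) (by positivity)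
    obtain ⟨N2, hN2⟩ := eventually_atTop.1 hT
    have hclose : ∀ n ≥ N2, |(f n (t + h) - f n t) / h - f1 n t| ≤ C * h := by
      intro n hn
      have := hN2 n hn (t + h) ⟨by linarith, by linarith⟩
      rw [add_sub_cancel_left, abs_of_pos hh0] at this
      rw [show (f n (t + h) - f n t) / h - f1 n t
        = (f n (t + h) - f n t - h * f1 n t) / h by field_simp, abs_div, abs_of_pos hh0,
        div_le_iff₀ hh0]
      exact this
    refine ⟨max N1 N2, fun n hn => ?_⟩
    have a1 := hN1 n ((le_max_left _ _).trans hn) (max N1 N2) (le_max_left _ _)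
    have a2 := abs_le.1 (hclose n ((le_max_right _ _).trans hn))
    have a3 := abs_le.1 (hclose (max N1 N2) (le_max_right _ _))
    rw [Real.dist_eq] at a1 ⊢
    have a4 := abs_lt.1 a1
    rw [abs_lt]
    constructor <;> linarith [a2.1, a2.2, a3.1, a3.2, a4.1, a4.2]
  obtain ⟨l, hl⟩ := cauchySeq_tendsto_of_complete hcau
  refine ⟨l, hl, ?_⟩
  have hlim : ∀ s ∈ Icc (t / 2) (2 * t), |F s - F t - (s - t) * l| ≤ C * |s - t| * |s - t| := by
    intro s hs
    have hlim := (((hF s (by linarith [hs.1])).sub (hF t ht)).sub (hl.const_mul (s - t))).abs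
    exact le_of_tendsto hlim (hT.mono fun n hn => hn s hs)
  rw [hasDerivAt_iff_isLittleO]
  have hO : (fun s => F s - F t - (s - t) • l) =O[𝓝 t] fun s => (s - t) ^ 2 := by
    refine Asymptotics.IsBigO.of_bound C ?_
    filter_upwards [Icc_mem_nhds (show t / 2 < t by linarith) (show t < 2 * t by linarith)]
      with s hs
    have := hlim s hs
    rw [Real.norm_eq_abs, Real.norm_eq_abs, smul_eq_mul, abs_pow]
    linarith [this, show C * |s - t| * |s - t| = C * |s - t| ^ 2 by ring]
  refine hO.trans_isLittleO ?_
  have h2 : Tendsto (fun s : ℝ => s - t) (𝓝 t) (𝓝 0) := by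
    simpa using (continuous_id.sub continuous_const).tendsto (x := t) (f := fun s : ℝ => s - t)
  have := (Asymptotics.isLittleO_pow_id (𝕜 := ℝ) (n := 2) (by norm_num)).comp_tendsto h2
  simpa [Function.comp_def] using this

theorem hasDerivAt_tower_of_tendsto {G : ℕ → ℕ → ℝ → ℝ} {F : ℝ → ℝ}
    (hG : ∀ k n, ∀ t > 0, HasDerivAt (G k n) (G (k + 1) n t) t)
    (hb : ∀ k a b, 0 < a → ∃ C, ∀ᶠ n in atTop, ∀ t ∈ Icc a b, |G (k + 2) n t| ≤ C)
    (hF : ∀ t > 0, Tendsto (fun n => G 0 n t) atTop (𝓝 (F t))) :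
    ∃ g : ℕ → ℝ → ℝ, ∀ k, ∀ t > 0, Tendsto (fun n => G k n t) atTop (𝓝 (g k t)) ∧
      HasDerivAt (g k) (g (k + 1) t) t := by
  have hstep : ∀ (k : ℕ) (H : ℝ → ℝ), (∀ t > 0, Tendsto (fun n => G k n t) atTop (𝓝 (H t))) →
      ∃ H1 : ℝ → ℝ, ∀ t > 0, Tendsto (fun n => G (k + 1) n t) atTop (𝓝 (H1 t)) ∧
        HasDerivAt H (H1 t) t := fun k H hH =>
    hasDerivAt_of_tendsto_of_deriv_bounded (hG k) (hG (k + 1)) (hb k) hH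
  choose! nxt hnxt using hstep
  let g : ℕ → ℝ → ℝ := fun k => Nat.rec F (fun k H => nxt k H) k
  have hg : ∀ k, ∀ t > 0, Tendsto (fun n => G k n t) atTop (𝓝 (g k t)) := by
    intro k
    induction k with
    | zero => exact hF
    | succ k ih => exact fun t ht => (hnxt k (g k) ih t ht).1
  exact ⟨g, fun k t ht => ⟨hg k t ht, (hnxt k (g k) (hg k) t ht).2⟩⟩

theorem iteratedDeriv_eq_of_tower {g : ℕ → ℝ → ℝ}
    (hg : ∀ k, ∀ t > 0, HasDerivAt (g k) (g (k + 1) t) t) {f : ℝ → ℝ}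
    (hf : ∀ t > 0, f t = g 0 t) (n : ℕ) : ∀ t > 0, iteratedDeriv n f t = g n t := by
  induction n with
  | zero => simpa using hf
  | succ n ih =>
    intro t ht
    rw [iteratedDeriv_succ]
    have : iteratedDeriv n f =ᶠ[𝓝 t] g n := by
      filter_upwards [Ioi_mem_nhds ht] with s hs using ih s hs
    rw [this.deriv_eq, (hg n t ht).deriv]

theorem contDiffOn_of_tower {g : ℕ → ℝ → ℝ}
    (hg : ∀ k, ∀ t > 0, HasDerivAt (g k) (g (k + 1) t) t) :
    ContDiffOn ℝ (⊤ : ℕ∞) (g 0) (Ioi 0) := by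
  refine contDiffOn_of_differentiableOn_deriv fun m _ => ?_
  have : EqOn (iteratedDerivWithin m (g 0) (Ioi 0)) (g m) (Ioi 0) := by
    intro t ht
    rw [iteratedDerivWithin_of_isOpen isOpen_Ioi ht]
    exact iteratedDeriv_eq_of_tower hg (fun _ _ => rfl) m t ht
  refine DifferentiableOn.congr (fun t ht => ?_) this
  exact (hg m t ht).differentiableAt.differentiableWithinAt

theorem exists_spectral_decomposition {ι : Type*} [Fintype ι] [DecidableEq ι]
    {A : Matrix ι ι ℝ} (hA : A.PosSemidef) :
    ∃ (y : ι → ℝ) (q : ι → ι → ℝ), (∀ j, 0 ≤ y j) ∧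
      (∀ j i, ∑ k, A i k * q j k = y j * q j i) ∧
      ∀ (v : ι → ℝ) i, ∑ j, (∑ k, v k * q j k) * q j i = v i := by
  refine ⟨hA.1.eigenvalues, fun j i => hA.1.eigenvectorBasis j i, hA.eigenvalues_nonneg,
    fun j i => ?_, fun v i => ?_⟩
  · have := congrFun (hA.1.mulVec_eigenvectorBasis j) i
    simpa [Matrix.mulVec, dotProduct] using this
  · have := congrArg (fun z : EuclideanSpace ℝ ι => z i)
      (hA.1.eigenvectorBasis.sum_repr' (WithLp.toLp 2 v))
    simpa [PiLp.inner_apply] using this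

theorem posSemidef_diagonal_sub_rank_one {ι : Type*} [Fintype ι] [DecidableEq ι]
    {w x : ι → ℝ} (hw : ∀ i, 0 ≤ w i) (hx : ∀ i, 0 ≤ x i) (hK : 0 < ∑ i, w i) :
    (Matrix.of fun i k => (if i = k then x i else 0) -
      √(w i * x i) * √(w k * x k) / ∑ i, w i : Matrix ι ι ℝ).PosSemidef := by
  refine Matrix.PosSemidef.of_dotProduct_mulVec_nonneg ?_ fun z => ?_
  · ext i k
    simp only [Matrix.conjTranspose_apply, Matrix.of_apply, star_trivial]
    by_cases h : i = k
    · subst h; rfl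
    · rw [if_neg h, if_neg (Ne.symm h), mul_comm (√(w k * x k))]
  · have hcs := Finset.sum_mul_sq_le_sq_mul_sq Finset.univ
      (fun i => √(w i)) (fun i => √(x i) * z i)
    simp only [mul_pow, Real.sq_sqrt (hw _), Real.sq_sqrt (hx _)] at hcs
    have e : star z ⬝ᵥ ((Matrix.of fun i k => (if i = k then x i else 0) -
        √(w i * x i) * √(w k * x k) / ∑ i, w i : Matrix ι ι ℝ).mulVec z) =
        (∑ i, x i * z i ^ 2) - (∑ i, √(w i) * (√(x i) * z i)) ^ 2 / ∑ i, w i := by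
      simp only [dotProduct, Matrix.mulVec, Matrix.of_apply, star_trivial, sub_mul,
        Finset.sum_sub_distrib, ite_mul, zero_mul, Finset.sum_ite_eq, Finset.mem_univ, if_true,
        mul_sub]
      congr 1
      · exact Finset.sum_congr rfl fun i _ => by ring
      · rw [sq, Finset.sum_mul_sum, Finset.sum_div]
        refine Finset.sum_congr rfl fun i _ => ?_
        rw [Finset.mul_sum, Finset.sum_div]
        refine Finset.sum_congr rfl fun k _ => ?_
        rw [Real.sqrt_mul (hw i), Real.sqrt_mul (hw k)]
        ring
    rw [e, sub_nonneg, div_le_iff₀ hK]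
    linarith

theorem hasDerivAt_integral_exp_neg (y t : ℝ) :
    HasDerivAt (fun t => ∫ s in (0 : ℝ)..t, Real.exp (-(y * s))) (Real.exp (-(y * t))) t :=
  intervalIntegral.integral_hasDerivAt_right
    (Continuous.intervalIntegrable (by fun_prop) _ _)
    (Continuous.stronglyMeasurableAtFilter (by fun_prop) _ _)
    (by fun_prop)

theorem hasDerivAt_exp_neg_mul (y t : ℝ) :
    HasDerivAt (fun t => Real.exp (-(y * t))) (-y * Real.exp (-(y * t))) t := by
  have := ((hasDerivAt_id t).const_mul y).neg.exp
  simp only [id, mul_one] at this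
  convert! this using 1
  simp only [Pi.neg_apply]
  ring

theorem mul_integral_exp_neg (y t : ℝ) :
    y * (∫ s in (0 : ℝ)..t, Real.exp (-(y * s))) = 1 - Real.exp (-(y * t)) := by
  have hd : ∀ t, HasDerivAt
      (fun t => y * (∫ s in (0 : ℝ)..t, Real.exp (-(y * s))) + Real.exp (-(y * t))) 0 t := by
    intro t
    convert! ((hasDerivAt_integral_exp_neg y t).const_mul y).add (hasDerivAt_exp_neg_mul y t) using 1
    ring
  have := is_const_of_deriv_eq_zero (fun t => (hd t).differentiableAt) (fun t => (hd t).deriv) t 0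
  simp only [intervalIntegral.integral_same, mul_zero, neg_zero, Real.exp_zero, zero_add] at this
  linarith

theorem conv_exp_eq {l : ℝ → ℝ} (x t : ℝ) :
    (∫ s in (0 : ℝ)..t, Real.exp (-(x * s)) * l (t - s)) =
      Real.exp (-(x * t)) * ∫ s in (0 : ℝ)..t, Real.exp (x * s) * l s := by
  have := intervalIntegral.integral_comp_sub_left (a := 0) (b := t)
    (fun s => Real.exp (-(x * (t - s))) * l s) t
  simp only [sub_sub_cancel, sub_self, sub_zero] at this
  rw [this, ← intervalIntegral.integral_const_mul]
  refine intervalIntegral.integral_congr fun s _ => ?_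
  rw [← mul_assoc, ← Real.exp_add]
  ring_nf

theorem hasDerivAt_conv_exp {l : ℝ → ℝ} (hl : Continuous l) (x t : ℝ) :
    HasDerivAt (fun t => ∫ s in (0 : ℝ)..t, Real.exp (-(x * s)) * l (t - s))
      (l t - x * ∫ s in (0 : ℝ)..t, Real.exp (-(x * s)) * l (t - s)) t := by
  simp only [conv_exp_eq]
  have h1 : HasDerivAt (fun t => ∫ s in (0 : ℝ)..t, Real.exp (x * s) * l s)
      (Real.exp (x * t) * l t) t :=
    intervalIntegral.integral_hasDerivAt_right
      (Continuous.intervalIntegrable (by fun_prop) _ _)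
      (Continuous.stronglyMeasurableAtFilter (by fun_prop) _ _)
      (Continuous.continuousAt (by fun_prop))
  convert! (hasDerivAt_exp_neg_mul x t).mul h1 using 1
  rw [← mul_assoc (Real.exp (-(x * t))), ← Real.exp_add, neg_add_cancel, Real.exp_zero]
  ring

theorem exists_conv_expSum_eq {ι : Type*} [Fintype ι]
    {w x : ι → ℝ} (hw : ∀ i, 0 ≤ w i) (hx : ∀ i, 0 ≤ x i) (hK : 0 < ∑ i, w i) :
    ∃ (c y : ι → ℝ) (l : ℝ → ℝ), (∀ j, 0 ≤ c j) ∧ (∀ j, 0 ≤ y j) ∧ 0 ≤ l 0 ∧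
      (∀ t, HasDerivAt l (∑ j, c j * Real.exp (-(y j * t))) t) ∧
      ∀ t, (∫ s in (0 : ℝ)..t, (∑ i, w i * Real.exp (-(x i * s))) * l (t - s)) = t := by
  classical
  obtain ⟨y, q, hy, hq, hv⟩ :=
    exists_spectral_decomposition (posSemidef_diagonal_sub_rank_one hw hx hK)
  set K := ∑ i, w i with hKdef
  set v : ι → ℝ := fun i => √(w i * x i) with hvdef
  set b : ι → ℝ := fun j => ∑ k, v k * q j k with hb
  have hq' : ∀ j i, x i * q j i = y j * q j i + v i * b j / K := by
    intro j i
    have := hq j i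
    simp only [Matrix.of_apply, sub_mul, Finset.sum_sub_distrib, ite_mul, zero_mul,
      Finset.sum_ite_eq, Finset.mem_univ, if_true] at this
    rw [← this, hb, Finset.mul_sum, Finset.sum_div, sub_add]
    rw [eq_comm, sub_eq_self, sub_eq_zero]
    exact Finset.sum_congr rfl fun k _ => by ring
  set E : ι → ℝ → ℝ := fun j t => ∫ s in (0 : ℝ)..t, Real.exp (-(y j * s)) with hE
  have hEd : ∀ j t, HasDerivAt (E j) (Real.exp (-(y j * t))) t := fun j t =>
    hasDerivAt_integral_exp_neg _ _
  have hEm : ∀ j t, y j * E j t = 1 - Real.exp (-(y j * t)) := fun j t =>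
    mul_integral_exp_neg _ _
  have hE0 : ∀ j, E j 0 = 0 := fun j => by simp [hE]
  set l : ℝ → ℝ := fun t => (1 + ∑ j, b j ^ 2 / K * E j t) / K with hl
  have hld : ∀ t, HasDerivAt l (∑ j, b j ^ 2 / K ^ 2 * Real.exp (-(y j * t))) t := by
    intro t
    convert! ((HasDerivAt.fun_sum (u := Finset.univ) fun j _ =>
      (hEd j t).const_mul (b j ^ 2 / K)).const_add 1).div_const K using 1
    rw [Finset.sum_div]
    exact Finset.sum_congr rfl fun j _ => by field_simp
  have hlc : Continuous l := continuous_iff_continuousAt.2 fun t => (hld t).continuousAt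
  refine ⟨fun j => b j ^ 2 / K ^ 2, y, l, fun j => by positivity, hy, ?_, hld, ?_⟩
  · simp only [hl, hE0, mul_zero, Finset.sum_const_zero, add_zero]
    positivity
  set p : ι → ℝ → ℝ := fun i t => ∫ s in (0 : ℝ)..t, Real.exp (-(x i * s)) * l (t - s) with hp
  have hpd : ∀ i t, HasDerivAt (p i) (l t - x i * p i t) t := fun i t =>
    hasDerivAt_conv_exp hlc _ _
  have hp0 : ∀ i, p i 0 = 0 := fun i => by simp [hp]
  set Q : ι → ℝ → ℝ := fun i t => ∑ j, b j * q j i / K * E j t with hQ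
  have hQd : ∀ i t, HasDerivAt (Q i) (v i * l t - x i * Q i t) t := by
    intro i t
    convert! HasDerivAt.fun_sum (u := Finset.univ) fun j _ =>
      (hEd j t).const_mul (b j * q j i / K) using 1
    have h1 : x i * Q i t = (∑ j, b j / K * q j i * (1 - Real.exp (-(y j * t)))) +
        v i / K * ∑ j, b j ^ 2 / K * E j t := by
      rw [hQ, Finset.mul_sum, Finset.mul_sum, ← Finset.sum_add_distrib]
      refine Finset.sum_congr rfl fun j _ => ?_
      rw [← hEm]
      linear_combination (b j / K * E j t) * hq' j i
    have h2 : (∑ j, b j / K * q j i * (1 - Real.exp (-(y j * t)))) =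
        v i / K - ∑ j, b j * q j i / K * Real.exp (-(y j * t)) := by
      rw [← hv v i, Finset.sum_div, ← Finset.sum_sub_distrib]
      exact Finset.sum_congr rfl fun j _ => by ring
    rw [h1, h2, hl]
    ring
  have hpQ : ∀ i t, v i * p i t = Q i t := by
    intro i t
    have hd : ∀ t, HasDerivAt (fun t => Real.exp (x i * t) * (v i * p i t - Q i t)) 0 t := by
      intro t
      have h1 := hasDerivAt_exp_neg_mul (-x i) t
      simp only [neg_mul, neg_neg] at h1
      convert! h1.mul (((hpd i t).const_mul (v i)).sub (hQd i t)) using 1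
      simp only [Pi.sub_apply]
      ring
    have h3 := is_const_of_deriv_eq_zero (fun t => (hd t).differentiableAt)
      (fun t => (hd t).deriv) t 0
    simp only [hp0, hQ, hE0, mul_zero, Finset.sum_const_zero, sub_zero, mul_eq_zero,
      Real.exp_ne_zero, false_or] at h3
    linarith
  have hvQ : ∀ t, ∑ i, v i * Q i t = K * l t - 1 := by
    intro t
    have : K * l t - 1 = ∑ j, b j ^ 2 / K * E j t := by
      simp only [hl]; field_simp; ring
    rw [this]
    simp only [hQ, Finset.mul_sum]
    rw [Finset.sum_comm]
    refine Finset.sum_congr rfl fun j _ => ?_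
    rw [sq, ← mul_div_assoc', mul_assoc]
    conv_rhs => rw [hb]; simp only [Finset.sum_mul]
    exact Finset.sum_congr rfl fun i _ => by ring
  intro t
  have hsum : ∀ t, (∫ s in (0 : ℝ)..t, (∑ i, w i * Real.exp (-(x i * s))) * l (t - s)) =
      ∑ i, w i * p i t := by
    intro t
    simp only [hp, ← intervalIntegral.integral_const_mul]
    rw [← intervalIntegral.integral_finsetSum]
    · refine intervalIntegral.integral_congr fun s _ => ?_
      simp only [Finset.sum_mul, mul_assoc]
    · exact fun i _ => Continuous.intervalIntegrable (by fun_prop) _ _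
  rw [hsum]
  have hd : ∀ t, HasDerivAt (fun t => (∑ i, w i * p i t) - t) 0 t := by
    intro t
    convert! (HasDerivAt.fun_sum (u := Finset.univ) fun i _ =>
      (hpd i t).const_mul (w i)).sub (hasDerivAt_id t) using 1
    have h4 : ∑ i, w i * (l t - x i * p i t) = K * l t - ∑ i, v i * Q i t := by
      rw [hKdef, Finset.sum_mul, ← Finset.sum_sub_distrib]
      refine Finset.sum_congr rfl fun i _ => ?_
      rw [← hpQ, ← mul_assoc (v i), hvdef, Real.mul_self_sqrt (mul_nonneg (hw i) (hx i))]
      ring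
    rw [h4, hvQ]
    ring
  have := is_const_of_deriv_eq_zero (fun t => (hd t).differentiableAt) (fun t => (hd t).deriv) t 0
  simp only [hp0, mul_zero, Finset.sum_const_zero, sub_zero] at this
  linarith
theorem ScalarCM.hasDerivAt {f : ℝ → ℝ} (hf : ScalarCM f) (n : ℕ) {t : ℝ} (ht : 0 < t) :
    HasDerivAt (fun s => (-1 : ℝ) ^ n * iteratedDeriv n f s)
      (-((-1 : ℝ) ^ (n + 1) * iteratedDeriv (n + 1) f t)) t := by
  have h1 : DifferentiableAt ℝ (iteratedDeriv n f) t := by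
    have h2 := hf.1.differentiableOn_iteratedDerivWithin (m := n)
      (by exact_mod_cast WithTop.coe_lt_coe.2 (ENat.natCast_lt_top n)) (uniqueDiffOn_Ioi 0)
    refine ((h2.congr fun s hs => ?_).differentiableAt (Ioi_mem_nhds ht))
    exact (iteratedDerivWithin_of_isOpen isOpen_Ioi hs).symm
  have h3 := h1.hasDerivAt.const_mul ((-1 : ℝ) ^ n)
  rw [← iteratedDeriv_succ] at h3
  convert! h3 using 1
  ring

theorem antitoneOn_of_hasDerivAt_neg {f g : ℝ → ℝ} (h : ∀ t > 0, HasDerivAt f (-g t) t)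
    (hg : ∀ t > 0, 0 ≤ g t) : AntitoneOn f (Ioi 0) := by
  refine antitoneOn_of_hasDerivWithinAt_nonpos (convex_Ioi 0)
    (fun t ht => (h t ht).continuousAt.continuousWithinAt) (f' := fun t => -g t) ?_ ?_
  · intro t ht
    rw [interior_Ioi] at ht
    exact (h t ht).hasDerivWithinAt
  · intro t ht
    rw [interior_Ioi] at ht
    linarith [hg t ht]

/-- The shift operator on real sequences. -/
def seqShift : Module.End ℝ (ℕ → ℝ) where
  toFun a k := a (k + 1)
  map_add' _ _ := rfl
  map_smul' _ _ := rfl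

theorem seqShift_pow_apply (a : ℕ → ℝ) (m k : ℕ) : (seqShift ^ m) a k = a (k + m) := by
  induction m generalizing k with
  | zero => rfl
  | succ m ih =>
    rw [pow_succ', Module.End.mul_apply]
    exact (ih (k + 1)).trans (by congr 1; ring)

theorem one_sub_seqShift_pow_nonneg {h t₀ : ℝ} (hh : 0 < h) (ht₀ : 0 < t₀) (m : ℕ)
    {φ : ℕ → ℝ → ℝ} (hd : ∀ n, ∀ t > 0, HasDerivAt (φ n) (-φ (n + 1) t) t)
    (hφ : ∀ n, ∀ t > 0, 0 ≤ φ n t) (k : ℕ) :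
    0 ≤ ((1 - seqShift) ^ m) (fun i : ℕ => φ 0 (t₀ + i * h)) k := by
  induction m generalizing φ with
  | zero => exact hφ 0 _ (by positivity)
  | succ m ih =>
    have h1 := ih (φ := fun n t => φ n t - φ n (t + h))
      (fun n t ht => by
        have := (hd n t ht).sub ((hd n (t + h) (by positivity)).comp_add_const t h)
        convert! this using 1
        ring)
      (fun n t ht => sub_nonneg.2 <| antitoneOn_of_hasDerivAt_neg (hd n) (hφ (n + 1))
        ht (show 0 < t + h by positivity) (by linarith))
    rw [pow_succ, Module.End.mul_apply]
    convert! h1 using 2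
    ext i
    simp only [LinearMap.sub_apply, Module.End.one_apply, seqShift, LinearMap.coe_mk,
      AddHom.coe_mk, Pi.sub_apply]
    push_cast
    ring_nf

theorem sum_choose_mul_one_sub_seqShift_pow (a : ℕ → ℝ) {j N : ℕ} (hj : j ≤ N) :
    ∑ k ∈ Finset.range (N + 1), ((k.choose j : ℝ) / N.choose j) *
      (N.choose k * ((1 - seqShift) ^ (N - k)) a k) = a j := by
  obtain ⟨M, rfl⟩ := Nat.exists_eq_add_of_le hj
  rw [add_assoc, Finset.sum_range_add, Finset.sum_eq_zero, zero_add]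
  · have hc : Commute seqShift (1 - seqShift) := by
      rw [commute_iff_eq]; noncomm_ring
    have h1 := congrArg (fun T : Module.End ℝ (ℕ → ℝ) => T a j) (hc.add_pow M)
    simp only [add_sub_cancel, one_pow, Module.End.one_apply, LinearMap.sum_apply,
      Finset.sum_apply] at h1
    rw [h1]
    refine Finset.sum_congr rfl fun m hm => ?_
    have hm' : m ≤ M := Nat.lt_succ_iff.1 (Finset.mem_range.1 hm)
    have h2 := Nat.choose_mul (n := j + M) (k := j + m) (s := j) (by omega)
    rw [Nat.add_sub_cancel_left, Nat.add_sub_cancel_left] at h2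
    have h3 : ((j + M).choose j : ℝ) ≠ 0 := by
      exact_mod_cast (Nat.choose_pos (by omega : j ≤ j + M)).ne'
    have h4 : ((j + M).choose (j + m) : ℝ) * (j + m).choose j =
      (j + M).choose j * M.choose m := by exact_mod_cast h2
    rw [show j + M - (j + m) = M - m by omega, ← Nat.cast_comm, Module.End.mul_apply,
      Module.End.mul_apply, Module.End.natCast_apply, Pi.smul_apply, seqShift_pow_apply,
      nsmul_eq_mul, ← mul_assoc]
    congr 1
    field_simp
    linarith
  · intro k hk
    rw [Nat.choose_eq_zero_of_lt (Finset.mem_range.1 hk)]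
    simp

theorem eventually_abs_choose_div_sub_pow_le (j : ℕ) {δ : ℝ} (hδ : 0 < δ) :
    ∀ᶠ N : ℕ in atTop, ∀ k ≤ N,
      |((k.choose j : ℝ) / N.choose j) - ((k : ℝ) / N) ^ j| ≤ δ := by
  induction j generalizing δ with
  | zero => simp [hδ.le]
  | succ j ih =>
    have hlim : ∀ᶠ N : ℕ in atTop, (j : ℝ) / (N - j) ≤ δ / 2 := by
      have : Tendsto (fun N : ℕ => (j : ℝ) / ((N : ℝ) - j)) atTop (𝓝 0) :=
        tendsto_const_nhds.div_atTop
          (tendsto_atTop_add_const_right _ _ tendsto_natCast_atTop_atTop)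
      exact (this.eventually_lt_const (half_pos hδ)).mono fun _ h => h.le
    filter_upwards [ih (half_pos hδ), hlim, eventually_gt_atTop j] with N hN hNj hjN k hk
    have hN0 : (0 : ℝ) < N := by exact_mod_cast (Nat.zero_le j).trans_lt hjN
    have hNj0 : (0 : ℝ) < N - j := by
      have : (j : ℝ) < N := by exact_mod_cast hjN
      linarith
    have hkN : (k : ℝ) ≤ N := by exact_mod_cast hk
    have hq0 : 0 ≤ (k : ℝ) / N := by positivity
    have hq1 : (k : ℝ) / N ≤ 1 := by rw [div_le_one hN0]; exact hkN
    have h0 := hN k hk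
    rcases lt_or_ge k j with hkj | hkj
    · rw [Nat.choose_eq_zero_of_lt hkj] at h0
      rw [Nat.choose_eq_zero_of_lt (hkj.trans j.lt_succ_self)]
      simp only [Nat.cast_zero, zero_div, zero_sub, abs_neg] at h0 ⊢
      rw [abs_of_nonneg (by positivity)] at h0 ⊢
      have := mul_le_mul_of_nonneg_left hq1 (pow_nonneg hq0 j)
      rw [pow_succ]
      linarith
    · have hkj' : (j : ℝ) ≤ k := by exact_mod_cast hkj
      have hp0 : 0 ≤ ((k.choose j : ℝ) / N.choose j) := by positivity
      have hp1 : ((k.choose j : ℝ) / N.choose j) ≤ 1 := by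
        rw [div_le_one (by exact_mod_cast Nat.choose_pos hjN.le)]
        exact_mod_cast Nat.choose_le_choose j hk
      have hrec : ((k.choose (j + 1) : ℝ) / N.choose (j + 1)) =
          ((k.choose j : ℝ) / N.choose j) * ((k - j) / (N - j)) := by
        have e1 : (k.choose (j + 1) : ℝ) * (j + 1) = k.choose j * (k - j) := by
          have := Nat.choose_succ_right_eq k j
          rw [← Nat.cast_sub hkj]
          exact_mod_cast this
        have e2 : (N.choose (j + 1) : ℝ) * (j + 1) = N.choose j * (N - j) := by
          have := Nat.choose_succ_right_eq N j
          rw [← Nat.cast_sub hjN.le]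
          exact_mod_cast this
        rw [div_mul_div_comm, ← e1, ← e2, mul_div_mul_right _ _ (by positivity)]
      have hr : |((k : ℝ) - j) / (N - j) - k / N| ≤ δ / 2 := by
        have : ((k : ℝ) - j) / (N - j) - k / N = -(j * (N - k) / (N * (N - j))) := by
          field_simp
          ring
        rw [this, abs_neg, abs_of_nonneg (by
          have : (0 : ℝ) ≤ N - k := by linarith
          positivity)]
        refine le_trans ?_ hNj
        rw [div_le_div_iff₀ (by positivity) hNj0]
        have : (j : ℝ) * (N - k) ≤ j * N :=
          mul_le_mul_of_nonneg_left (by linarith [(Nat.cast_nonneg k : (0:ℝ) ≤ k)]) (by positivity)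
        nlinarith
      rw [hrec, pow_succ]
      set p := ((k.choose j : ℝ) / N.choose j)
      set q := ((k : ℝ) / N)
      set r := ((k : ℝ) - j) / (N - j)
      have e : p * r - q ^ j * q = p * (r - q) + (p - q ^ j) * q := by ring
      rw [e]
      refine (abs_add_le _ _).trans ?_
      rw [abs_mul, abs_mul, abs_of_nonneg hp0, abs_of_nonneg hq0]
      have h5 := mul_le_mul hp1 hr (abs_nonneg _) zero_le_one
      have h6 := mul_le_mul h0 hq1 hq0 (half_pos hδ).le
      linarith

theorem ScalarCM.exists_expSum_approx {κ : ℝ → ℝ} (hκ : ScalarCM κ) {n : ℕ} (hn : 0 < n) :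
    ∃ (N : ℕ) (w x : Fin N → ℝ), (∀ i, 0 ≤ w i) ∧ (∀ i, 0 ≤ x i) ∧
      ∀ t : ℝ, 0 < t → t ≤ n →
        κ (t + 2 / n) - 1 / n ≤ ∑ i, w i * Real.exp (-(x i * t)) ∧
        ∑ i, w i * Real.exp (-(x i * t)) ≤ κ t + 1 / n := by
  have hn0 : (0 : ℝ) < n := by exact_mod_cast hn
  set h : ℝ := 1 / n with hh
  have hh0 : 0 < h := by positivity
  have hanti : AntitoneOn κ (Ioi 0) := by
    refine antitoneOn_of_hasDerivAt_neg (fun t ht => ?_) (hκ.2 1)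
    simpa using hκ.hasDerivAt 0 ht
  have hpos : ∀ t > 0, 0 ≤ κ t := fun t ht => by simpa using hκ.2 0 t ht
  set a : ℕ → ℝ := fun i => κ (h + i * h) with ha
  set W : ℕ → ℕ → ℝ := fun N k => N.choose k * ((1 - seqShift) ^ (N - k)) a k with hWdef
  have hW : ∀ N k, 0 ≤ W N k := by
    intro N k
    refine mul_nonneg (Nat.cast_nonneg _) ?_
    have := one_sub_seqShift_pow_nonneg hh0 hh0 (N - k)
      (φ := fun n t => (-1 : ℝ) ^ n * iteratedDeriv n κ t)
      (fun n t ht => hκ.hasDerivAt n ht) hκ.2 k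
    simpa using this
  have hsum : ∀ N j, j ≤ N →
      ∑ k ∈ Finset.range (N + 1), ((k.choose j : ℝ) / N.choose j) * W N k = a j :=
    fun N j hj => sum_choose_mul_one_sub_seqShift_pow a hj
  set δ : ℝ := h / (a 0 + 1) with hδdef
  have ha0 : 0 ≤ a 0 := hpos _ (by positivity)
  have hδ : 0 < δ := by positivity
  have hδa : δ * a 0 ≤ h := by
    rw [hδdef, div_mul_eq_mul_div, div_le_iff₀ (by positivity)]
    nlinarith
  have hev : ∀ᶠ N : ℕ in atTop, ∀ j ∈ Finset.range (n * n + 2), ∀ k ≤ N,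
      |((k.choose j : ℝ) / N.choose j) - ((k : ℝ) / N) ^ j| ≤ δ :=
    (Finset.eventually_all _).2 fun j _ => eventually_abs_choose_div_sub_pow_le j hδ
  obtain ⟨N, hN, hNn⟩ := (hev.and (eventually_ge_atTop (n * n + 2))).exists
  have hN0 : 0 < N := by omega
  have hN0' : (0 : ℝ) < N := by exact_mod_cast hN0
  have hgrid : ∀ j < n * n + 2,
      |a j - ∑ k ∈ Finset.range (N + 1), ((k : ℝ) / N) ^ j * W N k| ≤ h := by
    intro j hj
    rw [← hsum N j (by omega), ← Finset.sum_sub_distrib]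
    refine (Finset.abs_sum_le_sum_abs _ _).trans ?_
    have h0 : ∑ k ∈ Finset.range (N + 1), W N k = a 0 := by
      rw [← hsum N 0 (Nat.zero_le _)]
      simp
    refine le_trans ?_ hδa
    rw [← h0, Finset.mul_sum]
    refine Finset.sum_le_sum fun k hk => ?_
    rw [← sub_mul, abs_mul, abs_of_nonneg (hW N k)]
    exact mul_le_mul_of_nonneg_right
      (hN j (Finset.mem_range.2 hj) k (Nat.lt_succ_iff.1 (Finset.mem_range.1 hk))) (hW N k)
  set x : Fin N → ℝ := fun i => -(n * Real.log (((i : ℕ) + 1 : ℝ) / N)) with hx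
  set w : Fin N → ℝ := fun i => W N (i + 1) with hw
  set g : ℝ → ℝ := fun t => ∑ i, w i * Real.exp (-(x i * t)) with hg
  have hx0 : ∀ i, 0 ≤ x i := by
    intro i
    have : Real.log (((i : ℕ) + 1 : ℝ) / N) ≤ 0 := by
      refine Real.log_nonpos (by positivity) ?_
      rw [div_le_one hN0']
      exact_mod_cast i.2
    simp only [hx]
    nlinarith
  have hw0 : ∀ i, 0 ≤ w i := fun i => hW _ _
  have hganti : Antitone g := by
    intro s t hst
    refine Finset.sum_le_sum fun i _ => mul_le_mul_of_nonneg_left ?_ (hw0 i)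
    refine Real.exp_le_exp.2 (neg_le_neg ?_)
    exact mul_le_mul_of_nonneg_left hst (hx0 i)
  have hgj : ∀ j : ℕ, ∑ k ∈ Finset.range (N + 1), ((k : ℝ) / N) ^ j * W N k =
      g (j * h) + (0 : ℝ) ^ j * W N 0 := by
    intro j
    rw [Finset.sum_range_succ', Finset.sum_range]
    simp only [Nat.cast_zero, zero_div]
    congr 1
    refine Finset.sum_congr rfl fun i _ => ?_
    rw [mul_comm]
    simp only [hw, hx]
    congr 1
    have h1 : -(-(n * Real.log (((i : ℕ) + 1 : ℝ) / N)) * (j * h)) =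
        j * Real.log (((i : ℕ) + 1 : ℝ) / N) := by
      rw [hh]; field_simp
    rw [h1, Real.exp_nat_mul, Real.exp_log (by positivity)]
    push_cast
    rfl
  refine ⟨N, w, x, hw0, hx0, fun t ht htn => ?_⟩
  change κ (t + 2 / n) - 1 / n ≤ g t ∧ g t ≤ κ t + 1 / n
  set j := ⌊t * n⌋₊ with hj
  have hj1 : (j : ℝ) ≤ t * n := Nat.floor_le (mul_nonneg ht.le hn0.le)
  have hj2 : t * n < j + 1 := Nat.lt_floor_add_one _
  have hjn : j ≤ n * n := by
    have : (j : ℝ) ≤ n * n := hj1.trans (by gcongr)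
    exact_mod_cast this
  have hjh : j * h ≤ t := by
    rw [hh, mul_one_div, div_le_iff₀ hn0]; exact hj1
  have hjh2 : t ≤ (j + 1) * h := by
    rw [hh, mul_one_div, le_div_iff₀ hn0]; exact hj2.le
  have e1 := abs_le.1 (hgrid j (by omega))
  have e2 := abs_le.1 (hgrid (j + 1) (by omega))
  rw [hgj] at e1 e2
  have e3 : 0 ≤ (0 : ℝ) ^ j * W N 0 := mul_nonneg (pow_nonneg le_rfl j) (hW _ _)
  rw [pow_succ, mul_zero, zero_mul, add_zero] at e2
  push_cast at e2
  rw [← hh]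
  constructor
  · have h1 : g ((j + 1) * h) ≤ g t := hganti hjh2
    have h2 : κ (t + 2 / n) ≤ a (j + 1) := by
      refine hanti ?_ ?_ ?_
      · show 0 < h + ((j + 1 : ℕ) : ℝ) * h
        positivity
      · show 0 < t + 2 / n
        positivity
      · have : (2 : ℝ) / n = 2 * h := by rw [hh]; ring
        rw [this]
        push_cast
        linarith
    linarith [e2.1, e2.2]
  · have h1 : g t ≤ g (j * h) := hganti hjh
    have h2 : a j ≤ κ t := by
      refine hanti ht ?_ ?_
      · show 0 < h + (j : ℝ) * h
        positivity
      · linarith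
    linarith [e1.1, e1.2]
theorem convolution_indicator_Ioc_apply (f g : ℝ → ℝ) {T x : ℝ} (hx0 : 0 < x) (hxT : x ≤ T) :
    convolution (indicator (Ioc 0 T) f) (indicator (Ioc 0 T) g)
      (ContinuousLinearMap.mul ℝ ℝ) volume x = ∫ s in (0 : ℝ)..x, f s * g (x - s) := by
  rw [convolution, intervalIntegral.integral_of_le hx0.le, integral_Ioc_eq_integral_Ioo,
    ← integral_indicator measurableSet_Ioo]
  congr 1 with s
  simp only [ContinuousLinearMap.mul_apply', indicator_apply, mem_Ioc, mem_Ioo]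
  by_cases h1 : 0 < s <;> by_cases h2 : s < x
  · rw [if_pos ⟨h1, by linarith⟩, if_pos ⟨by linarith, by linarith⟩, if_pos ⟨h1, h2⟩]
  · rw [if_neg (c := 0 < x - s ∧ x - s ≤ T) (fun h => h2 (by linarith [h.1])),
      if_neg (c := 0 < s ∧ s < x) (fun h => h2 h.2), mul_zero]
  · rw [if_neg (c := 0 < s ∧ s ≤ T) (fun h => h1 h.1),
      if_neg (c := 0 < s ∧ s < x) (fun h => h1 h.1), zero_mul]
  · rw [if_neg (c := 0 < s ∧ s ≤ T) (fun h => h1 h.1),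
      if_neg (c := 0 < s ∧ s < x) (fun h => h1 h.1), zero_mul]

theorem convolution_indicator_Ioc_of_nonpos (f g : ℝ → ℝ) {T x : ℝ} (hx0 : x ≤ 0) :
    convolution (indicator (Ioc 0 T) f) (indicator (Ioc 0 T) g)
      (ContinuousLinearMap.mul ℝ ℝ) volume x = 0 := by
  rw [convolution]
  refine integral_eq_zero_of_ae (Eventually.of_forall fun s => ?_)
  simp only [ContinuousLinearMap.mul_apply', indicator_apply, mem_Ioc, Pi.zero_apply]
  by_cases h1 : 0 < s
  · rw [if_neg (c := 0 < x - s ∧ x - s ≤ T) (fun h => by linarith [h.1]), mul_zero]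
  · rw [if_neg (fun h => h1 h.1), zero_mul]

/-- Associativity of the convolution on a half line, in terms of interval integrals. -/
theorem intervalIntegral_conv_assoc {f g k : ℝ → ℝ} {C T : ℝ} (hT : 0 < T)
    (hf : IntegrableOn f (Ioc 0 T)) (hfC : ∀ s ∈ Ioc 0 T, |f s| ≤ C)
    (hg : IntegrableOn g (Ioc 0 T)) (hk : IntegrableOn k (Ioc 0 T)) :
    ∫ s in (0 : ℝ)..T, (∫ u in (0 : ℝ)..s, f u * g (s - u)) * k (T - s) =
      ∫ s in (0 : ℝ)..T, f s * ∫ u in (0 : ℝ)..(T - s), g u * k (T - s - u) := by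
  set L := ContinuousLinearMap.mul ℝ ℝ
  have hf' := (integrable_indicator_iff measurableSet_Ioc).2 hf
  have hg' := (integrable_indicator_iff measurableSet_Ioc).2 hg
  have hk' := (integrable_indicator_iff measurableSet_Ioc).2 hk
  set F := indicator (Ioc 0 T) f with hF
  set G := indicator (Ioc 0 T) g with hG
  set K := indicator (Ioc 0 T) k with hK
  have hassoc : convolution (convolution F G L volume) K L volume T =
      convolution F (convolution G K L volume) L volume T := by
    refine convolution_assoc L L L L (fun x y z => mul_assoc x y z) hf'.1 hg'.1 hk'.1
      (hf'.ae_convolution_exists L hg') (hg'.norm.ae_convolution_exists _ hk'.norm) ?_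
    have hGK : Integrable (convolution (fun x => ‖G x‖) (fun x => ‖K x‖) L volume) :=
      hg'.norm.integrable_convolution L hk'.norm
    refine (hGK.comp_sub_left T).bdd_mul (c := max C 0) hf'.norm.1 (Eventually.of_forall fun s => ?_)
    rw [norm_norm, hF, indicator_apply]
    split_ifs with h
    · exact (hfC s h).trans (le_max_left _ _)
    · rw [norm_zero]; exact le_max_right _ _
  have hleft : convolution (convolution F G L volume) K L volume T =
      ∫ s in (0 : ℝ)..T, (∫ u in (0 : ℝ)..s, f u * g (s - u)) * k (T - s) := by
    rw [convolution, intervalIntegral.integral_of_le hT.le, integral_Ioc_eq_integral_Ioo,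
      ← integral_indicator measurableSet_Ioo]
    congr 1 with s
    change convolution F G L volume s * K (T - s) = _
    by_cases hs : s ∈ Ioo 0 T
    · rw [indicator_of_mem hs, convolution_indicator_Ioc_apply f g hs.1 hs.2.le, hK,
        indicator_of_mem (show T - s ∈ Ioc 0 T from ⟨by linarith [hs.2], by linarith [hs.1]⟩)]
    · rw [indicator_of_notMem hs]
      rcases le_or_gt s 0 with h | h
      · rw [convolution_indicator_Ioc_of_nonpos f g h, zero_mul]
      · have : T - s ∉ Ioc 0 T := fun h' => hs ⟨h, by linarith [h'.1]⟩
        rw [hK, indicator_of_notMem this, mul_zero]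
  have hright : convolution F (convolution G K L volume) L volume T =
      ∫ s in (0 : ℝ)..T, f s * ∫ u in (0 : ℝ)..(T - s), g u * k (T - s - u) := by
    rw [convolution, intervalIntegral.integral_of_le hT.le, integral_Ioc_eq_integral_Ioo,
      ← integral_indicator measurableSet_Ioo]
    congr 1 with s
    change F s * convolution G K L volume (T - s) = _
    by_cases hs : s ∈ Ioo 0 T
    · rw [indicator_of_mem hs, convolution_indicator_Ioc_apply g k (by linarith [hs.2])
        (by linarith [hs.1]), hF, indicator_of_mem (Ioo_subset_Ioc_self hs)]
    · rw [indicator_of_notMem hs]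
      rcases le_or_gt s 0 with h | h
      · rw [hF, indicator_of_notMem (fun h' => absurd h'.1 (not_lt.2 h)), zero_mul]
      · have : T - s ≤ 0 := by
          by_contra h'
          exact hs ⟨h, by linarith⟩
        rw [convolution_indicator_Ioc_of_nonpos g k this, mul_zero]
  rw [← hleft, hassoc, hright]

theorem intervalIntegral_conv_comm (f g : ℝ → ℝ) (t : ℝ) :
    ∫ s in (0 : ℝ)..t, f s * g (t - s) = ∫ s in (0 : ℝ)..t, g s * f (t - s) := by
  have := intervalIntegral.integral_comp_sub_left (a := 0) (b := t)
    (fun s => g s * f (t - s)) t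
  simp only [sub_sub_cancel, sub_self, sub_zero] at this
  rw [← this]
  exact intervalIntegral.integral_congr fun s _ => mul_comm _ _

theorem integral_id_mul_eq_of_conv_eq {κ l d : ℝ → ℝ} {C T : ℝ} (hT : 0 < T)
    (hl : IntegrableOn l (Ioc 0 T)) (hlC : ∀ s ∈ Ioc 0 T, |l s| ≤ C)
    (hκ : IntegrableOn κ (Ioc 0 T)) (hd : IntegrableOn d (Ioc 0 T))
    (hsol : ∀ t > 0, ∫ s in (0 : ℝ)..t, κ s * l (t - s) = t) :
    ∫ s in (0 : ℝ)..T, s * d (T - s) =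
      ∫ s in (0 : ℝ)..T, l s * ∫ u in (0 : ℝ)..(T - s), κ u * d (T - s - u) := by
  rw [← intervalIntegral_conv_assoc hT hl hlC hκ hd]
  refine intervalIntegral.integral_congr_ae (Eventually.of_forall fun s hs => ?_)
  rw [uIoc_of_le hT.le] at hs
  rw [intervalIntegral_conv_comm l κ, hsol s hs.1]

theorem ae_eq_zero_of_conv_eq_zero {κ l d : ℝ → ℝ}
    (hl : ∀ T > 0, IntegrableOn l (Ioc 0 T)) (hlC : ∀ T > 0, ∃ C, ∀ s ∈ Ioc 0 T, |l s| ≤ C)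
    (hκ : ∀ T > 0, IntegrableOn κ (Ioc 0 T)) (hd : ∀ T > 0, IntegrableOn d (Ioc 0 T))
    (hsol : ∀ t > 0, ∫ s in (0 : ℝ)..t, κ s * l (t - s) = t)
    (hd0 : ∀ t > 0, ∫ s in (0 : ℝ)..t, κ s * d (t - s) = 0) :
    ∀ᵐ t : ℝ, t ∈ Ioi (0 : ℝ) → d t = 0 := by
  set d' := indicator (Ioi 0) d with hd'
  have hd'li : LocallyIntegrable d' := by
    rw [locallyIntegrable_iff]
    intro S hS
    obtain ⟨b, hb⟩ := hS.bddAbove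
    have h1 : IntegrableOn d' (Iic (max b 1)) := by
      rw [hd', IntegrableOn, integrable_indicator_iff measurableSet_Ioi, IntegrableOn,
        Measure.restrict_restrict measurableSet_Ioi, Ioi_inter_Iic]
      exact hd _ (by positivity)
    exact h1.mono_set fun s hs => (hb hs).trans (le_max_left _ _)
  have hd'd : ∀ T ≥ 0, ∫ s in (0 : ℝ)..T, d' s = ∫ s in (0 : ℝ)..T, d s := by
    intro T hT
    refine intervalIntegral.integral_congr_ae (Eventually.of_forall fun s hs => ?_)
    rw [uIoc_of_le hT] at hs
    exact indicator_of_mem (show s ∈ Ioi 0 from hs.1) d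
  set D : ℝ → ℝ := fun x => ∫ s in (0 : ℝ)..x, d' s with hD
  have hDc : Continuous D :=
    intervalIntegral.continuous_primitive (fun a b =>
      (LocallyIntegrable.integrableOn_isCompact hd'li isCompact_uIcc).intervalIntegrable) 0
  have hDint : ∀ T > 0, ∫ s in (0 : ℝ)..T, D s = 0 := by
    intro T hT
    obtain ⟨C, hC⟩ := hlC T hT
    have h1 := integral_id_mul_eq_of_conv_eq hT (hl T hT) hC (hκ T hT) (hd T hT) hsol
    have h2 : ∫ s in (0 : ℝ)..T, l s * ∫ u in (0 : ℝ)..(T - s), κ u * d (T - s - u) = 0 := by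
      rw [intervalIntegral.integral_of_le hT.le, integral_Ioc_eq_integral_Ioo]
      refine setIntegral_eq_zero_of_forall_eq_zero fun s hs => ?_
      rw [hd0 _ (by linarith [hs.2]), mul_zero]
    have hone : IntegrableOn (fun _ : ℝ => (1 : ℝ)) (Ioc 0 T) :=
      integrableOn_const (by simp)
    have h3 := intervalIntegral_conv_assoc (C := 1) hT hone (by simp) hone (hd T hT)
    simp only [mul_one, one_mul, intervalIntegral.integral_const, sub_zero, smul_eq_mul] at h3
    rw [h1, h2] at h3
    have h4 : ∀ x, ∫ u in (0 : ℝ)..x, d (x - u) = ∫ u in (0 : ℝ)..x, d u := by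
      intro x
      simp
    simp only [h4] at h3
    rw [intervalIntegral.integral_comp_sub_left (a := 0) (b := T)
      (fun x => ∫ u in (0 : ℝ)..x, d u) T, sub_self, sub_zero] at h3
    refine Eq.trans ?_ h3.symm
    refine intervalIntegral.integral_congr fun s hs => ?_
    rw [uIcc_of_le hT.le] at hs
    exact hd'd s hs.1
  have hD0 : ∀ T > 0, D T = 0 := by
    intro T hT
    have h1 : HasDerivAt (fun T => ∫ s in (0 : ℝ)..T, D s) (D T) T :=
      intervalIntegral.integral_hasDerivAt_right (hDc.intervalIntegrable _ _)
        (hDc.stronglyMeasurableAtFilter _ _) hDc.continuousAt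
    have h2 : (fun T => ∫ s in (0 : ℝ)..T, D s) =ᶠ[𝓝 T] fun _ => 0 := by
      filter_upwards [Ioi_mem_nhds hT] with s hs using hDint s hs
    rw [← h1.deriv, h2.deriv_eq, deriv_const]
  filter_upwards [LocallyIntegrable.ae_hasDerivAt_integral hd'li] with t ht ht0
  have h1 : (fun T => ∫ s in (0 : ℝ)..T, d' s) =ᶠ[𝓝 t] fun _ => 0 := by
    filter_upwards [Ioi_mem_nhds ht0] with s hs using hD0 s hs
  have h2 := (ht 0).deriv
  rw [h1.deriv_eq, deriv_const] at h2
  rw [← indicator_of_mem ht0 d]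
  exact h2.symm

/-- `g` is a finite sum of decaying exponentials approximating `κ` up to `1 / n`, and `l` solves
`g ∗ l = id`; `D k` is the derivative of `l` of order `k + 1`. -/
structure IsExpSolution (κ : ℝ → ℝ) (n : ℕ) (g l : ℝ → ℝ) (D : ℕ → ℝ → ℝ) : Prop where
  continuous : Continuous g
  nonneg : ∀ t, 0 ≤ g t
  lower : ∀ t : ℝ, 0 < t → t ≤ n → κ (t + 2 / n) - 1 / n ≤ g t
  upper : ∀ t : ℝ, 0 < t → t ≤ n → g t ≤ κ t + 1 / n
  zero_nonneg : 0 ≤ l 0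
  hasDerivAt : ∀ t, HasDerivAt l (D 0 t) t
  hasDerivAt_D : ∀ k t, HasDerivAt (D k) (D (k + 1) t) t
  sign : ∀ k t, 0 ≤ (-1) ^ k * D k t
  abs_D_le : ∀ k, ∀ t > 0, |D k t| ≤ k.factorial * (2 / t) ^ k * D 0 (t / 2)
  conv_eq : ∀ t, ∫ s in (0:ℝ)..t, g s * l (t - s) = t

theorem pow_mul_exp_neg_le {y t : ℝ} (hy : 0 ≤ y) (ht : 0 < t) (k : ℕ) :
    y ^ k * Real.exp (-(y * t)) ≤ k.factorial * (2 / t) ^ k * Real.exp (-(y * (t / 2))) := by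
  have h := Real.pow_div_factorial_le_exp (x := y * (t / 2)) (by positivity) k
  have hf : (0:ℝ) < k.factorial := by positivity
  rw [div_le_iff₀ hf] at h
  have h1 : y ^ k = (2 / t) ^ k * (y * (t / 2)) ^ k := by
    rw [← mul_pow]; congr 1; field_simp
  have h2 : Real.exp (-(y * t)) = Real.exp (-(y * (t / 2))) * Real.exp (-(y * (t / 2))) := by
    rw [← Real.exp_add]; congr 1; ring
  have h3 : Real.exp (y * (t / 2)) * Real.exp (-(y * (t / 2))) = 1 := by
    rw [← Real.exp_add]; simp
  rw [h1, h2]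
  have h4 : 0 ≤ (2 / t) ^ k * (Real.exp (-(y * (t / 2))) * Real.exp (-(y * (t / 2)))) := by
    positivity
  calc _ = (y * (t / 2)) ^ k *
        ((2 / t) ^ k * (Real.exp (-(y * (t / 2))) * Real.exp (-(y * (t / 2))))) := by ring
    _ ≤ (Real.exp (y * (t / 2)) * k.factorial) *
        ((2 / t) ^ k * (Real.exp (-(y * (t / 2))) * Real.exp (-(y * (t / 2))))) :=
        mul_le_mul_of_nonneg_right h h4
    _ = (Real.exp (y * (t / 2)) * Real.exp (-(y * (t / 2)))) *
        (k.factorial * (2 / t) ^ k * Real.exp (-(y * (t / 2)))) := by ring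
    _ = _ := by rw [h3, one_mul]

theorem ScalarCM.exists_isExpSolution {κ : ℝ → ℝ} (hκ : ScalarCM κ) {n : ℕ} (hn : 0 < n) {t : ℝ}
    (ht : 0 < t) (htn : t ≤ n) (hpos : 1 / (n : ℝ) < κ (t + 2 / n)) :
    ∃ g l D, IsExpSolution κ n g l D := by
  obtain ⟨N, w, x, hw, hx, hb⟩ := hκ.exists_expSum_approx hn
  have hK : 0 < ∑ i, w i := by
    refine (Finset.sum_nonneg fun i _ => hw i).lt_of_ne' fun h0 => ?_
    have hz := (Finset.sum_eq_zero_iff_of_nonneg fun i _ => hw i).1 h0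
    have := (hb t ht htn).1
    rw [Finset.sum_eq_zero fun i hi => by rw [hz i hi, zero_mul]] at this
    linarith
  obtain ⟨c, y, l, hc, hy, hl0, hl, hconv⟩ := exists_conv_expSum_eq hw hx hK
  refine ⟨fun t => ∑ i, w i * Real.exp (-(x i * t)), l,
    fun k t => ∑ j, c j * ((-y j) ^ k * Real.exp (-(y j * t))),
    ⟨by fun_prop, fun t => Finset.sum_nonneg fun i _ => mul_nonneg (hw i) (Real.exp_pos _).le,
      fun t h1 h2 => (hb t h1 h2).1, fun t h1 h2 => (hb t h1 h2).2, hl0,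
      fun t => by simpa using hl t, fun k t => ?_, fun k t => ?_, fun k t ht => ?_, hconv⟩⟩
  · have : HasDerivAt (fun t => ∑ j, c j * ((-y j) ^ k * Real.exp (-(y j * t))))
        (∑ j, c j * ((-y j) ^ k * (-y j * Real.exp (-(y j * t))))) t :=
      HasDerivAt.fun_sum fun j _ => ((hasDerivAt_exp_neg_mul (y j) t).const_mul _).const_mul _
    refine this.congr_deriv (Finset.sum_congr rfl fun j _ => ?_)
    rw [pow_succ]; ring
  · rw [Finset.mul_sum]
    refine Finset.sum_nonneg fun j _ => ?_
    rw [neg_pow (y j), show (-1 : ℝ) ^ k * (c j * ((-1) ^ k * y j ^ k * Real.exp (-(y j * t)))) =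
      ((-1) * (-1)) ^ k * (c j * (y j ^ k * Real.exp (-(y j * t)))) by rw [mul_pow]; ring]
    have := hc j; have := hy j
    norm_num
    positivity
  · refine (Finset.abs_sum_le_sum_abs _ _).trans ?_
    rw [Finset.mul_sum]
    refine Finset.sum_le_sum fun j _ => ?_
    rw [abs_mul, abs_mul, abs_pow, abs_neg, abs_of_nonneg (hc j), abs_of_nonneg (hy j), Real.abs_exp,
      pow_zero, one_mul]
    linarith [mul_le_mul_of_nonneg_left (pow_mul_exp_neg_le (hy j) ht k) (hc j)]

theorem ScalarCM.exists_isExpSolution_seq {κ : ℝ → ℝ} (hκ : ScalarCM κ)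
    (hnz : ∃ t ∈ Ioi (0:ℝ), κ t ≠ 0) : ∃ (n₀ : ℕ) (g l : ℕ → ℝ → ℝ) (D : ℕ → ℕ → ℝ → ℝ),
      ∀ n, IsExpSolution κ (n + n₀) (g n) (l n) (D n) := by
  obtain ⟨t, ht, hne⟩ := hnz
  have ht : 0 < t := ht
  have hpos : 0 < κ t := lt_of_le_of_ne (by simpa using hκ.2 0 t ht) hne.symm
  have hanti : AntitoneOn κ (Ioi 0) :=
    antitoneOn_of_hasDerivAt_neg (fun t ht => by simpa using hκ.hasDerivAt 0 ht) (hκ.2 1)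
  have h1 : Tendsto (fun n : ℕ => 1 / (n : ℝ)) atTop (𝓝 0) := tendsto_one_div_atTop_nhds_zero_nat
  have h2 : Tendsto (fun n : ℕ => 2 / (n : ℝ)) atTop (𝓝 0) := tendsto_const_div_atTop_nhds_zero_nat 2
  obtain ⟨n₀, hn₀⟩ := eventually_atTop.1 ((h1.eventually_lt_const hpos).and
    ((h2.eventually_lt_const (half_pos ht)).and
      ((tendsto_natCast_atTop_atTop (R := ℝ)).eventually_ge_atTop t |>.and
        (eventually_gt_atTop 0))))
  have : ∀ n : ℕ, ∃ g l D, IsExpSolution κ (n + n₀) g l D := fun n => by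
    obtain ⟨ha, hb, hc, hd⟩ := hn₀ (n + n₀) (Nat.le_add_left _ _)
    refine hκ.exists_isExpSolution hd (half_pos ht) (by linarith) (ha.trans_le ?_)
    have : 0 < 2 / ((n + n₀ : ℕ) : ℝ) := by positivity
    exact hanti (mem_Ioi.2 (by positivity)) ht (by linarith)
  choose g l D h using this
  exact ⟨n₀, g, l, D, h⟩

namespace IsExpSolution

variable {κ g l g' l' : ℝ → ℝ} {D D' : ℕ → ℝ → ℝ} {n n' : ℕ}

theorem continuous_sol (h : IsExpSolution κ n g l D) : Continuous l :=
  continuous_iff_continuousAt.2 fun t => (h.hasDerivAt t).continuousAt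

theorem monotone_sol (h : IsExpSolution κ n g l D) : Monotone l :=
  monotone_of_hasDerivAt_nonneg h.hasDerivAt fun t => by simpa using h.sign 0 t

theorem sol_nonneg (h : IsExpSolution κ n g l D) {t : ℝ} (ht : 0 ≤ t) : 0 ≤ l t :=
  h.zero_nonneg.trans (h.monotone_sol ht)

theorem mul_integral_le (h : IsExpSolution κ n g l D) {a T : ℝ} (ha : 0 ≤ a) (hT : 0 ≤ T) :
    l T * ∫ s in (0:ℝ)..a, g s ≤ T + a := by
  have hc := h.continuous_sol
  have hg := h.continuous
  have hi : ∀ b c, IntervalIntegrable (fun s => g s * l (T + a - s)) volume b c := fun b c =>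
    (by fun_prop : Continuous fun s => g s * l (T + a - s)).intervalIntegrable b c
  rw [← h.conv_eq (T + a), ← intervalIntegral.integral_add_adjacent_intervals (hi 0 a) (hi a (T + a)),
    ← intervalIntegral.integral_const_mul]
  have h1 : ∫ s in (0:ℝ)..a, l T * g s ≤ ∫ s in (0:ℝ)..a, g s * l (T + a - s) := by
    refine intervalIntegral.integral_mono_on ha ((hg.const_mul _).intervalIntegrable _ _) (hi _ _)
      fun s hs => ?_
    rw [mul_comm]
    exact mul_le_mul_of_nonneg_left (h.monotone_sol (by linarith [hs.2])) (h.nonneg s)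
  have h2 : 0 ≤ ∫ s in a..(T + a), g s * l (T + a - s) :=
    intervalIntegral.integral_nonneg (by linarith) fun s hs =>
      mul_nonneg (h.nonneg s) (h.sol_nonneg (by linarith [hs.2]))
  linarith

theorem D_zero_mul_le (h : IsExpSolution κ n g l D) {t : ℝ} (ht : 0 < t) : D 0 t * t ≤ l t := by
  have hD : AntitoneOn (D 0) univ := by
    refine fun x _ y _ hxy => antitone_of_hasDerivAt_nonpos (h.hasDerivAt_D 0) (fun s => ?_) hxy
    simpa using h.sign 1 s
  have := Convex.mul_sub_le_image_sub_of_le_deriv (D := Icc 0 t) (f := l) (C := D 0 t)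
    (convex_Icc 0 t) h.continuous_sol.continuousOn
    (fun s _ => (h.hasDerivAt s).differentiableAt.differentiableWithinAt)
    (fun s hs => by
      rw [(h.hasDerivAt s).deriv]
      exact hD trivial trivial (interior_subset hs).2) 0 ⟨le_rfl, ht.le⟩ t ⟨ht.le, le_rfl⟩ ht.le
  linarith [h.zero_nonneg]

theorem abs_integral_id_mul_sub_le (h : IsExpSolution κ n g l D) (h' : IsExpSolution κ n' g' l' D')
    {T : ℝ} (hT : 0 < T) :
    |(∫ s in (0:ℝ)..T, s * l' (T - s)) - ∫ s in (0:ℝ)..T, s * l (T - s)| ≤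
      l T * (l' T * ∫ s in (0:ℝ)..T, |g s - g' s|) * T := by
  have hl := h.continuous_sol
  have hl' := h'.continuous_sol
  have hg := h.continuous
  have hg' := h'.continuous
  have hIoc : ∀ {f : ℝ → ℝ}, Continuous f → IntegrableOn f (Ioc 0 T) := fun hf =>
    hf.integrableOn_Icc.mono_set Ioc_subset_Icc_self
  have e1 := integral_id_mul_eq_of_conv_eq (C := l T) hT (hIoc hl) (fun s hs => by
    rw [abs_of_nonneg (h.sol_nonneg hs.1.le)]; exact h.monotone_sol hs.2) (hIoc hg) (hIoc hl')
    (fun t _ => h.conv_eq t)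
  have e2 : ∫ s in (0:ℝ)..T, s * l (T - s) =
      ∫ s in (0:ℝ)..T, l s * ∫ u in (0:ℝ)..(T - s), g' u * l' (T - s - u) := by
    rw [intervalIntegral_conv_comm (fun s => s) l]
    exact intervalIntegral.integral_congr fun s _ => by simp only [h'.conv_eq]
  have hcont : ∀ {f : ℝ → ℝ}, Continuous f → Continuous fun s =>
      l s * ∫ u in (0:ℝ)..(T - s), f u * l' (T - s - u) := fun hf =>
    hl.mul (intervalIntegral.continuous_parametric_intervalIntegral_of_continuous
      (by fun_prop) (by fun_prop))
  rw [e1, e2, ← intervalIntegral.integral_sub ((hcont hg).intervalIntegrable _ _)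
    ((hcont hg').intervalIntegrable _ _), ← Real.norm_eq_abs]
  have key : ∀ s ∈ uIoc 0 T, ‖(l s * ∫ u in (0:ℝ)..(T - s), g u * l' (T - s - u)) -
      l s * ∫ u in (0:ℝ)..(T - s), g' u * l' (T - s - u)‖ ≤
      l T * (l' T * ∫ s in (0:ℝ)..T, |g s - g' s|) := by
    intro s hs
    rw [uIoc_of_le hT.le] at hs
    have hd : Continuous fun u => |g u - g' u| := by fun_prop
    rw [← mul_sub, ← intervalIntegral.integral_sub
      ((by fun_prop : Continuous fun u => g u * l' (T - s - u)).intervalIntegrable _ _)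
      ((by fun_prop : Continuous fun u => g' u * l' (T - s - u)).intervalIntegrable _ _),
      norm_mul, Real.norm_of_nonneg (h.sol_nonneg hs.1.le)]
    refine mul_le_mul (h.monotone_sol hs.2) ?_ (norm_nonneg _) (h.sol_nonneg hT.le)
    have hTs : 0 ≤ T - s := by linarith [hs.2]
    calc _ ≤ ∫ u in (0:ℝ)..(T - s), l' T * |g u - g' u| := by
          refine intervalIntegral.norm_integral_le_of_norm_le hTs (ae_of_all _ fun u hu => ?_)
            ((hd.const_mul _).intervalIntegrable _ _)
          rw [← sub_mul, norm_mul, mul_comm, Real.norm_eq_abs (g u - g' u),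
            Real.norm_of_nonneg (h'.sol_nonneg (by linarith [hu.2]))]
          exact mul_le_mul_of_nonneg_right (h'.monotone_sol (by linarith [hu.1, hs.1]))
            (abs_nonneg _)
      _ = l' T * ∫ u in (0:ℝ)..(T - s), |g u - g' u| := intervalIntegral.integral_const_mul _ _
      _ ≤ _ := by
          refine mul_le_mul_of_nonneg_left ?_ (h'.sol_nonneg hT.le)
          exact intervalIntegral.integral_mono_interval le_rfl hTs (by linarith [hs.1])
            (ae_of_all _ fun u => abs_nonneg _) (hd.intervalIntegrable _ _)
  have := intervalIntegral.norm_integral_le_of_norm_le_const key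
  rwa [sub_zero, abs_of_pos hT] at this

end IsExpSolution

theorem ScalarCM.antitoneOn {κ : ℝ → ℝ} (hκ : ScalarCM κ) : AntitoneOn κ (Ioi 0) :=
  antitoneOn_of_hasDerivAt_neg (fun t ht => by simpa using hκ.hasDerivAt 0 ht) (hκ.2 1)

theorem ScalarCM.nonneg {κ : ℝ → ℝ} (hκ : ScalarCM κ) {t : ℝ} (ht : 0 < t) : 0 ≤ κ t := by
  simpa using hκ.2 0 t ht

theorem ScalarLICM.integrableOn {κ : ℝ → ℝ} (hκ : ScalarLICM κ) (T : ℝ) :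
    IntegrableOn κ (Ioc 0 T) := by
  have h : IntegrableOn κ (Icc 1 T) :=
    (hκ.1.1.continuousOn.mono fun t ht => lt_of_lt_of_le one_pos ht.1).integrableOn_Icc
  refine (hκ.2.union h).mono_set fun t ht => ?_
  rcases le_total t 1 with h1 | h1
  · exact Or.inl ⟨ht.1, h1⟩
  · exact Or.inr ⟨h1, ht.2⟩

theorem ScalarLICM.intervalIntegrable {κ : ℝ → ℝ} (hκ : ScalarLICM κ) {T : ℝ} (hT : 0 ≤ T) :
    IntervalIntegrable κ volume 0 T :=
  (intervalIntegrable_iff_integrableOn_Ioc_of_le hT).2 (hκ.integrableOn T)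

namespace IsExpSolution

variable {κ : ℝ → ℝ} {n₀ : ℕ} {g l : ℕ → ℝ → ℝ} {D : ℕ → ℕ → ℝ → ℝ}

theorem eventually_le_natCast_add (T : ℝ) (n₀ : ℕ) : ∀ᶠ n : ℕ in atTop, T ≤ ((n + n₀ : ℕ) : ℝ) :=
  (tendsto_natCast_atTop_atTop.comp (tendsto_add_atTop_nat n₀)).eventually_ge_atTop T

theorem tendsto (hκ : ScalarCM κ) (h : ∀ n, IsExpSolution κ (n + n₀) (g n) (l n) (D n)) {t : ℝ}
    (ht : 0 < t) : Tendsto (fun n => g n t) atTop (𝓝 (κ t)) := by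
  have h1 : Tendsto (fun n : ℕ => 1 / ((n + n₀ : ℕ) : ℝ)) atTop (𝓝 0) :=
    tendsto_one_div_atTop_nhds_zero_nat.comp (tendsto_add_atTop_nat n₀)
  have h2 : Tendsto (fun n : ℕ => 2 / ((n + n₀ : ℕ) : ℝ)) atTop (𝓝 0) :=
    (tendsto_const_div_atTop_nhds_zero_nat 2).comp (tendsto_add_atTop_nat n₀)
  have hc : Tendsto κ (𝓝 t) (𝓝 (κ t)) := hκ.1.continuousOn.continuousAt (Ioi_mem_nhds ht)
  have h3 : Tendsto (fun n : ℕ => t + 2 / ((n + n₀ : ℕ) : ℝ)) atTop (𝓝 t) := by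
    simpa using h2.const_add t
  have h4 := (hc.comp h3).sub h1
  have h5 := h1.const_add (κ t)
  rw [sub_zero] at h4
  rw [add_zero] at h5
  refine tendsto_of_tendsto_of_tendsto_of_le_of_le' h4 h5 ?_ ?_
  · filter_upwards [eventually_le_natCast_add t n₀] with n hn using (h n).lower t ht hn
  · filter_upwards [eventually_le_natCast_add t n₀] with n hn using (h n).upper t ht hn

theorem eventually_le_add_one (h : ∀ n, IsExpSolution κ (n + n₀) (g n) (l n) (D n)) (T : ℝ) :
    ∀ᶠ n in atTop, ∀ s ∈ Ioc 0 T, g n s ≤ κ s + 1 := by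
  filter_upwards [eventually_le_natCast_add T n₀, eventually_le_natCast_add 1 n₀] with n hn hn1 s hs
  have h1 := (h n).upper s hs.1 (hs.2.trans hn)
  have h2 : 1 / ((n + n₀ : ℕ) : ℝ) ≤ 1 := by rw [div_le_one (by linarith)]; exact hn1
  linarith

theorem tendsto_integral_abs_sub (hκ : ScalarLICM κ)
    (h : ∀ n, IsExpSolution κ (n + n₀) (g n) (l n) (D n)) {T : ℝ} (hT : 0 ≤ T) :
    Tendsto (fun n => ∫ s in (0:ℝ)..T, |g n s - κ s|) atTop (𝓝 0) := by
  have hlim : Tendsto (fun n => ∫ s in (0:ℝ)..T, |g n s - κ s|) atTop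
      (𝓝 (∫ s in (0:ℝ)..T, (0:ℝ))) := by
    refine intervalIntegral.tendsto_integral_filter_of_dominated_convergence (fun s => κ s + 1)
      (Eventually.of_forall fun n => ?_) ?_ ((hκ.intervalIntegrable hT).add (by simp))
      (ae_of_all _ fun s hs => ?_)
    · rw [uIoc_of_le hT]
      exact ((h n).continuous.aestronglyMeasurable.sub (hκ.integrableOn T).1).norm
    · filter_upwards [eventually_le_add_one h T] with n hn
      refine ae_of_all _ fun s hs => ?_
      rw [uIoc_of_le hT] at hs
      rw [Real.norm_eq_abs, abs_abs, abs_le]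
      have h1 := hn s hs
      have h2 := (h n).nonneg s
      have h3 := hκ.1.nonneg hs.1
      constructor <;> linarith
    · rw [uIoc_of_le hT] at hs
      simpa using ((tendsto hκ.1 h hs.1).sub_const (κ s)).abs
  simpa using hlim

theorem exists_eventually_sol_le (hκ : ScalarLICM κ) (hnz : ∃ t ∈ Ioi (0:ℝ), κ t ≠ 0)
    (h : ∀ n, IsExpSolution κ (n + n₀) (g n) (l n) (D n)) :
    ∃ C a : ℝ, 0 ≤ C ∧ 0 ≤ a ∧ ∀ᶠ n in atTop, ∀ T ≥ 0, l n T ≤ C * (T + a) := by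
  obtain ⟨a, ha, hne⟩ := hnz
  have ha : 0 < a := ha
  have hpos : 0 < κ a := (hκ.1.nonneg ha).lt_of_ne' hne
  have hi := hκ.intervalIntegrable ha.le
  set I := ∫ s in (0:ℝ)..a, κ s with hI
  have hI0 : 0 < I := by
    have : ∫ s in (0:ℝ)..a, κ a ≤ I :=
      intervalIntegral.integral_mono_on_of_le_Ioo ha.le (by simp) hi fun s hs =>
        hκ.1.antitoneOn hs.1 ha hs.2.le
    rw [intervalIntegral.integral_const, sub_zero, smul_eq_mul] at this
    exact (mul_pos ha hpos).trans_le this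
  refine ⟨2 / I, a, by positivity, ha.le, ?_⟩
  filter_upwards [(tendsto_integral_abs_sub hκ h ha.le).eventually_lt_const (half_pos hI0)]
    with n hn T hT
  have hgi : IntervalIntegrable (g n) volume 0 a := (h n).continuous.intervalIntegrable _ _
  have h1 : I / 2 ≤ ∫ s in (0:ℝ)..a, g n s := by
    have := intervalIntegral.abs_integral_le_integral_abs (f := fun s => g n s - κ s)
      (μ := volume) ha.le
    rw [intervalIntegral.integral_sub hgi hi, ← hI] at this
    linarith [(abs_le.1 this).1]
  have h2 := (h n).mul_integral_le ha.le hT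
  have h3 := mul_le_mul_of_nonneg_left h1 ((h n).sol_nonneg hT)
  rw [div_mul_eq_mul_div, le_div_iff₀ hI0]
  linarith

theorem exists_tendsto_integral_id_mul (hκ : ScalarLICM κ) (hnz : ∃ t ∈ Ioi (0:ℝ), κ t ≠ 0)
    (h : ∀ n, IsExpSolution κ (n + n₀) (g n) (l n) (D n)) {T : ℝ} (hT : 0 < T) :
    ∃ c, Tendsto (fun n => ∫ s in (0:ℝ)..T, s * l n (T - s)) atTop (𝓝 c) := by
  obtain ⟨C, a, hC, ha, hB⟩ := exists_eventually_sol_le hκ hnz h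
  set B := C * (T + a) with hBdef
  have hB0 : 0 ≤ B := by positivity
  set δ := fun n => ∫ s in (0:ℝ)..T, |g n s - κ s| with hδ
  have hδ0 : ∀ n, 0 ≤ δ n := fun n =>
    intervalIntegral.integral_nonneg hT.le fun s _ => abs_nonneg _
  have hδi : ∀ n, IntervalIntegrable (fun s => |g n s - κ s|) volume 0 T := fun n =>
    (((h n).continuous.intervalIntegrable _ _).sub (hκ.intervalIntegrable hT.le)).abs
  have hlim : Tendsto (fun p : ℕ × ℕ => B * (B * (δ p.1 + δ p.2)) * T) atTop (𝓝 0) := by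
    have hd := tendsto_integral_abs_sub hκ h hT.le
    rw [← prod_atTop_atTop_eq]
    have := ((((hd.comp tendsto_fst).add (hd.comp tendsto_snd)).const_mul B).const_mul B).mul_const T
    simpa using this
  refine cauchySeq_tendsto_of_complete (cauchySeq_iff_tendsto_dist_atTop_0.2
    (squeeze_zero' (Eventually.of_forall fun _ => dist_nonneg) ?_ hlim))
  rw [← prod_atTop_atTop_eq]
  filter_upwards [hB.prod_mk hB] with p hp
  rw [dist_comm, Real.dist_eq]
  refine ((h p.1).abs_integral_id_mul_sub_le (h p.2) hT).trans ?_
  have hi : IntervalIntegrable (fun s => |g p.1 s - g p.2 s|) volume 0 T := by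
    have h1 := (h p.1).continuous
    have h2 := (h p.2).continuous
    exact (by fun_prop : Continuous fun s => |g p.1 s - g p.2 s|).intervalIntegrable _ _
  have hsub : ∫ s in (0:ℝ)..T, |g p.1 s - g p.2 s| ≤ δ p.1 + δ p.2 := by
    rw [← intervalIntegral.integral_add (hδi p.1) (hδi p.2)]
    refine intervalIntegral.integral_mono_on hT.le hi ((hδi p.1).add (hδi p.2)) fun s _ => ?_
    rw [abs_sub_comm (g p.2 s)]
    exact abs_sub_le _ _ _
  have h0 : 0 ≤ ∫ s in (0:ℝ)..T, |g p.1 s - g p.2 s| :=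
    intervalIntegral.integral_nonneg hT.le fun s _ => abs_nonneg _
  have hl := (h p.2).sol_nonneg hT.le
  have := hp.1 T hT.le
  have := hp.2 T hT.le
  gcongr

end IsExpSolution

/-- The double primitive and primitive of `l`, then `l`, then its derivatives `D 0, D 1, …`. -/
def derivTower (l : ℝ → ℝ) (D : ℕ → ℝ → ℝ) : ℕ → ℝ → ℝ
  | 0 => fun t => t * (∫ s in (0:ℝ)..t, l s) - ∫ s in (0:ℝ)..t, s * l s
  | 1 => fun t => ∫ s in (0:ℝ)..t, l s
  | 2 => l
  | k + 3 => D k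

namespace IsExpSolution

theorem hasDerivAt_derivTower {κ g l : ℝ → ℝ} {D : ℕ → ℝ → ℝ} {n : ℕ}
    (h : IsExpSolution κ n g l D) (k : ℕ) (t : ℝ) :
    HasDerivAt (derivTower l D k) (derivTower l D (k + 1) t) t := by
  have hl := h.continuous_sol
  have h1 : HasDerivAt (fun t => ∫ s in (0:ℝ)..t, l s) (l t) t :=
    hl.integral_hasStrictDerivAt 0 t |>.hasDerivAt
  match k with
  | 0 =>
    have h2 : HasDerivAt (fun t => ∫ s in (0:ℝ)..t, s * l s) (t * l t) t :=
      (continuous_id.mul hl).integral_hasStrictDerivAt 0 t |>.hasDerivAt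
    refine (((hasDerivAt_id t).mul h1).sub h2).congr_deriv ?_
    simp [derivTower]
  | 1 => exact h1
  | 2 => exact h.hasDerivAt t
  | k + 3 => exact h.hasDerivAt_D k t

theorem derivTower_zero {l : ℝ → ℝ} (hl : Continuous l) (D : ℕ → ℝ → ℝ) (t : ℝ) :
    derivTower l D 0 t = ∫ s in (0:ℝ)..t, s * l (t - s) := by
  rw [intervalIntegral_conv_comm (fun s => s) l, derivTower]
  beta_reduce
  rw [← intervalIntegral.integral_const_mul,
    ← intervalIntegral.integral_sub ((hl.const_mul t).intervalIntegrable _ _)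
      ((by fun_prop : Continuous fun s => s * l s).intervalIntegrable _ _)]
  exact intervalIntegral.integral_congr fun s _ => by ring

variable {κ : ℝ → ℝ} {n₀ : ℕ} {g l : ℕ → ℝ → ℝ} {D : ℕ → ℕ → ℝ → ℝ}

theorem exists_eventually_abs_derivTower_le (hκ : ScalarLICM κ)
    (hnz : ∃ t ∈ Ioi (0:ℝ), κ t ≠ 0) (h : ∀ n, IsExpSolution κ (n + n₀) (g n) (l n) (D n))
    (k : ℕ) {a b : ℝ} (ha : 0 < a) :
    ∃ M, ∀ᶠ n in atTop, ∀ t ∈ Icc a b, |derivTower (l n) (D n) (k + 2) t| ≤ M := by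
  obtain ⟨C, c, hC, hc, hB⟩ := exists_eventually_sol_le hκ hnz h
  match k with
  | 0 =>
    refine ⟨C * (b + c), hB.mono fun n hn t ht => ?_⟩
    have ht0 : 0 ≤ t := ha.le.trans ht.1
    change |l n t| ≤ _
    rw [abs_of_nonneg ((h n).sol_nonneg ht0)]
    exact (hn t ht0).trans (mul_le_mul_of_nonneg_left (by linarith [ht.2]) hC)
  | k + 1 =>
    refine ⟨k.factorial * (2 / a) ^ k * (C * (b + c) / (a / 2)), hB.mono fun n hn t ht => ?_⟩
    have ht0 : 0 < t := ha.trans_le ht.1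
    have hD0 : 0 ≤ D n 0 (t / 2) := by simpa using (h n).sign 0 (t / 2)
    have h1 : D n 0 (t / 2) ≤ C * (b + c) / (a / 2) := by
      rw [le_div_iff₀ (by positivity)]
      calc _ ≤ D n 0 (t / 2) * (t / 2) := by gcongr; exact ht.1
        _ ≤ l n (t / 2) := (h n).D_zero_mul_le (by positivity)
        _ ≤ C * (t / 2 + c) := hn _ (by positivity)
        _ ≤ _ := mul_le_mul_of_nonneg_left (by linarith [ht.2]) hC
    refine ((h n).abs_D_le k t ht0).trans ?_
    have := ht.1
    gcongr

theorem exists_tendsto_derivTower (hκ : ScalarLICM κ)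
    (hnz : ∃ t ∈ Ioi (0:ℝ), κ t ≠ 0) (h : ∀ n, IsExpSolution κ (n + n₀) (g n) (l n) (D n)) :
    ∃ γ : ℕ → ℝ → ℝ, ∀ k, ∀ t > 0,
      Tendsto (fun n => derivTower (l n) (D n) (k + 2) t) atTop (𝓝 (γ k t)) ∧
      HasDerivAt (γ k) (γ (k + 1) t) t := by
  have hex : ∀ t : ℝ, ∃ c, 0 < t → Tendsto (fun n => derivTower (l n) (D n) 0 t) atTop (𝓝 c) :=
    fun t => by
      by_cases ht : 0 < t
      · obtain ⟨c, hc⟩ := exists_tendsto_integral_id_mul hκ hnz h ht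
        exact ⟨c, fun _ => by simpa only [derivTower_zero (h _).continuous_sol] using hc⟩
      · exact ⟨0, fun h => (ht h).elim⟩
  choose F hF using hex
  obtain ⟨γ, hγ⟩ := hasDerivAt_tower_of_tendsto (G := fun k n => derivTower (l n) (D n) k)
    (fun k n t _ => (h n).hasDerivAt_derivTower k t)
    (fun k a b ha => exists_eventually_abs_derivTower_le hκ hnz h k ha) hF
  exact ⟨fun k => γ (k + 2), fun k => hγ (k + 2)⟩

end IsExpSolution

theorem ScalarLICM.exists_bernstein_conv_eq {κ : ℝ → ℝ} (hκ : ScalarLICM κ)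
    (hnz : ∃ t ∈ Ioi (0:ℝ), κ t ≠ 0) : ∃ lam : ℝ → ℝ, ScalarBernstein lam ∧
      (∀ T, ∃ C, ∀ s ∈ Ioc 0 T, |lam s| ≤ C) ∧
      ∀ t ∈ Ioi (0:ℝ), (∫ s in (0:ℝ)..t, κ s * lam (t - s)) = t := by
  obtain ⟨n₀, g, l, D, h⟩ := hκ.1.exists_isExpSolution_seq hnz
  obtain ⟨γ, hγ⟩ := IsExpSolution.exists_tendsto_derivTower hκ hnz h
  obtain ⟨C, a, hC, ha, hB⟩ := IsExpSolution.exists_eventually_sol_le hκ hnz h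
  have hlim : ∀ t > 0, Tendsto (fun n => l n t) atTop (𝓝 (γ 0 t)) := fun t ht => (hγ 0 t ht).1
  have h0 : ∀ t > 0, 0 ≤ γ 0 t := fun t ht =>
    ge_of_tendsto' (hlim t ht) fun n => (h n).sol_nonneg (le_of_lt ht)
  have hle : ∀ t > 0, γ 0 t ≤ C * (t + a) := fun t ht =>
    le_of_tendsto (hlim t ht) (hB.mono fun n hn => hn t (le_of_lt ht))
  have hderiv : ∀ t > 0, deriv (γ 0) t = γ 1 t := fun t ht => (hγ 0 t ht).2.deriv
  have htower : ∀ k, ∀ t > 0, HasDerivAt (γ (k + 1)) (γ (k + 1 + 1) t) t :=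
    fun k t ht => (hγ (k + 1) t ht).2
  refine ⟨γ 0, ⟨h0, fun t ht => (hγ 0 t ht).2.differentiableAt.differentiableWithinAt,
    (contDiffOn_of_tower (g := fun k => γ (k + 1)) htower).congr hderiv, fun k t ht => ?_⟩,
    fun T => ⟨C * (T + a), fun s hs => ?_⟩, fun t ht => ?_⟩
  · rw [iteratedDeriv_eq_of_tower (g := fun k => γ (k + 1)) htower hderiv k t ht]
    exact ge_of_tendsto' ((hγ (k + 1) t ht).1.const_mul _) fun n => (h n).sign k t
  · rw [abs_of_nonneg (h0 s hs.1)]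
    exact (hle s hs.1).trans (mul_le_mul_of_nonneg_left (by linarith [hs.2]) hC)
  · have ht : 0 < t := ht
    have hconv : Tendsto (fun n => ∫ s in (0:ℝ)..t, g n s * l n (t - s)) atTop
        (𝓝 (∫ s in (0:ℝ)..t, κ s * γ 0 (t - s))) := by
      refine intervalIntegral.tendsto_integral_filter_of_dominated_convergence
        (fun s => (κ s + 1) * (C * (t + a))) (Eventually.of_forall fun n => ?_) ?_
        (((hκ.intervalIntegrable ht.le).add (by simp)).mul_const _) ?_
      · have h1 := (h n).continuous
        have h2 := (h n).continuous_sol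
        exact (by fun_prop : Continuous fun s => g n s * l n (t - s)).aestronglyMeasurable
      · filter_upwards [hB, IsExpSolution.eventually_le_add_one h t] with n hn hn1
        refine ae_of_all _ fun s hs => ?_
        rw [uIoc_of_le ht.le] at hs
        have hts : 0 ≤ t - s := by linarith [hs.2]
        rw [norm_mul, Real.norm_of_nonneg ((h n).nonneg s),
          Real.norm_of_nonneg ((h n).sol_nonneg hts)]
        exact mul_le_mul (hn1 s hs) ((hn _ hts).trans
          (mul_le_mul_of_nonneg_left (by linarith [hs.1]) hC)) ((h n).sol_nonneg hts)
          (by linarith [hκ.1.nonneg hs.1])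
      · filter_upwards [Measure.ae_ne volume t] with s hst hs
        rw [uIoc_of_le ht.le] at hs
        exact (IsExpSolution.tendsto hκ.1 h hs.1).mul
          (hlim _ (sub_pos.2 (hs.2.lt_of_ne hst)))
    exact tendsto_nhds_unique hconv (by simp only [(h _).conv_eq]; exact tendsto_const_nhds)

theorem ScalarLICM.integrableOn_of_conv {κ μ : ℝ → ℝ} (hκ : ScalarLICM κ)
    (hnz : ∃ t ∈ Ioi (0:ℝ), κ t ≠ 0) (hμ : LocallyIntegrableOn μ (Ioi 0))
    (hi : ∀ t > 0, IntervalIntegrable (fun s => κ s * μ (t - s)) volume 0 t) (T : ℝ) :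
    IntegrableOn μ (Ioc 0 T) := by
  obtain ⟨a, ha, hne⟩ := hnz
  have ha : 0 < a := ha
  have hpos : 0 < κ a := (hκ.1.nonneg ha).lt_of_ne' hne
  have hge : ∀ s ∈ Ioc 0 a, κ a ≤ κ s := fun s hs => hκ.1.antitoneOn hs.1 ha hs.2
  have h1 := (intervalIntegrable_iff_integrableOn_Ioc_of_le ha.le).1 (hi a ha)
  have hcont : ContinuousOn (fun s => (κ s)⁻¹) (Ioc 0 a) :=
    (hκ.1.1.continuousOn.mono fun s hs => hs.1).inv₀ fun s hs => (hpos.trans_le (hge s hs)).ne'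
  have h2 : IntegrableOn (fun s => (κ s)⁻¹ * (κ s * μ (a - s))) (Ioc 0 a) := by
    refine Integrable.bdd_mul (c := (κ a)⁻¹) h1 (hcont.aestronglyMeasurable measurableSet_Ioc)
      ((ae_restrict_iff' measurableSet_Ioc).2 (ae_of_all _ fun s hs => ?_))
    have := hge s hs
    rw [Real.norm_of_nonneg (inv_nonneg.2 (hpos.le.trans this))]
    gcongr
  have h3 : IntegrableOn (fun s => μ (a - s)) (Ioc 0 a) := by
    refine h2.congr_fun (fun s hs => ?_) measurableSet_Ioc
    have := (hpos.trans_le (hge s hs)).ne'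
    simp only
    field_simp
  have h4 : IntegrableOn μ (Ioc 0 a) := by
    have := ((intervalIntegrable_iff_integrableOn_Ioc_of_le ha.le).2 h3).comp_sub_left a
    simp only [sub_sub_cancel, sub_zero, sub_self] at this
    exact (intervalIntegrable_iff_integrableOn_Ioc_of_le ha.le).1 this.symm
  have h5 : IntegrableOn μ (Icc a T) :=
    hμ.integrableOn_compact_subset (fun s hs => ha.trans_le hs.1) isCompact_Icc
  refine (h4.union h5).mono_set fun s hs => ?_
  rcases le_total s a with h | h
  · exact Or.inl ⟨hs.1, h⟩
  · exact Or.inr ⟨h, hs.2⟩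

/-- If `κ` is a not-identically-zero LICM function, then the equation
`(κ∗λ)(t) = t` on `(0,∞)` has a solution `λ` which is a Bernstein function, and this
solution is unique among locally integrable functions (up to a.e. equality). -/
theorem licm_conv_eq_t_unique_solution (κ : ℝ → ℝ) (hκ : ScalarLICM κ)
    (hnz : ∃ t ∈ Set.Ioi (0:ℝ), κ t ≠ 0) :
    ∃ lam : ℝ → ℝ, ScalarBernstein lam ∧
      (∀ t ∈ Set.Ioi (0:ℝ), (∫ s in (0:ℝ)..t, κ s * lam (t - s)) = t) ∧
      ∀ μ : ℝ → ℝ, LocallyIntegrableOn μ (Set.Ioi 0) →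
        (∀ t ∈ Set.Ioi (0:ℝ), (∫ s in (0:ℝ)..t, κ s * μ (t - s)) = t) →
        ∀ᵐ t : ℝ ∂MeasureTheory.volume, t ∈ Set.Ioi (0:ℝ) → μ t = lam t := by
  obtain ⟨lam, hB, hbd, hsol⟩ := hκ.exists_bernstein_conv_eq hnz
  refine ⟨lam, hB, hsol, fun μ hμ hμsol => ?_⟩
  have hii : ∀ {f : ℝ → ℝ}, (∀ t ∈ Ioi (0:ℝ), (∫ s in (0:ℝ)..t, κ s * f (t - s)) = t) →
      ∀ t > 0, IntervalIntegrable (fun s => κ s * f (t - s)) volume 0 t := fun hf t ht =>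
    intervalIntegral.intervalIntegrable_of_integral_ne_zero (by rw [hf t ht]; exact ht.ne')
  have hlam := hκ.integrableOn_of_conv hnz
    (hB.2.1.continuousOn.locallyIntegrableOn measurableSet_Ioi) (hii hsol)
  have hμi := hκ.integrableOn_of_conv hnz hμ (hii hμsol)
  have := ae_eq_zero_of_conv_eq_zero (l := lam) (d := fun t => μ t - lam t) (fun T _ => hlam T)
    (fun T _ => hbd T) (fun T _ => hκ.integrableOn T) (fun T _ => (hμi T).sub (hlam T)) hsol
    fun t ht => by
      simp only [mul_sub]
      rw [intervalIntegral.integral_sub (hii hμsol t ht) (hii hsol t ht), hμsol t ht, hsol t ht,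
        sub_self]
  exact this.mono fun t h ht => sub_eq_zero.1 (h ht)
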